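/- arXiv:1509.07296 — 2 statements merged into one kernel-verified Lean document; each statement's English description precedes it below -/
import Mathlib

section
/- (Degree bounds for dual spanning forest polynomials.) Let G be a Feynman graph, let p = {p_1,…,p_n} be pairwise disjoint nonempty subsets of the external vertex set V_ext, and let F ∈ F_G^p be a spanning forest compatible with p. Then for every subgraph g = (V_g, E_g) of G with V_g ≠ ∅ one has (number of g-internal vertices) ≤ |F ∩ E_g| ≤ |V_g| − 1. Consequently, every monomial of the dual spanning forest polynomial Ψ̃_G^p contains at least (number of g-internal vertices) and at most |V_g| − 1 factors α_e with e ∈ E_g (counted with multiplicity). -/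
open scoped Classical ENNReal
open MeasureTheory

noncomputable section

/-- A Feynman graph with vertices `Fin nV`, edges `Fin nE` (each edge has two
distinct endpoints, multiple edges allowed), a set of external vertices and
real edge weights. -/
structure FeynmanGraph (nV nE : ℕ) where
  ends : Fin nE → Fin nV × Fin nV
  ends_ne : ∀ e, (ends e).1 ≠ (ends e).2
  ext : Finset (Fin nV)
  ν : Fin nE → ℝ

/-- `λ = d/2 - 1`. -/
def lam (d : ℕ) : ℝ := (d : ℝ) / 2 - 1

namespace FeynmanGraph

variable {nV nE : ℕ} (G : FeynmanGraph nV nE)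

/-- The edge `e` is incident to the vertex `v`. -/
def Incident (e : Fin nE) (v : Fin nV) : Prop :=
  (G.ends e).1 = v ∨ (G.ends e).2 = v

/-- The edge `e` joins the vertices `u` and `v`. -/
def Joins (e : Fin nE) (u v : Fin nV) : Prop :=
  G.ends e = (u, v) ∨ G.ends e = (v, u)

/-- The internal vertices of `G`. -/
def intVerts : Finset (Fin nV) := Finset.univ.filter (fun v => v ∉ G.ext)

/-- The simple graph on the vertices of `G` induced by a subset `F` of the edges. -/
def edgeGraph (F : Finset (Fin nE)) : SimpleGraph (Fin nV) :=
  SimpleGraph.fromRel (fun u v => ∃ e ∈ F, G.Joins e u v)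

/-- `F` is a spanning forest of `G` compatible with the collection `p` of pairwise
disjoint vertex sets: `F` is acyclic (as a set of multigraph edges), the graph
`(V, F)` has exactly `p.card` connected components, and distinct parts of `p` lie in
distinct components.  (Acyclicity together with the component count is expressed by
the edge count `F.card + p.card = nV`.) -/
def IsForest (p : Finset (Finset (Fin nV))) (F : Finset (Fin nE)) : Prop :=
  F.card + p.card = nV ∧
  Nat.card (G.edgeGraph F).ConnectedComponent = p.card ∧
  (∀ P ∈ p, ∀ u ∈ P, ∀ v ∈ P, (G.edgeGraph F).Reachable u v) ∧
  (∀ P ∈ p, ∀ Q ∈ p, P ≠ Q → ∀ u ∈ P, ∀ v ∈ Q, ¬ (G.edgeGraph F).Reachable u v)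

/-- The set `𝓕_G^p` of spanning forests compatible with `p`. -/
def forests (p : Finset (Finset (Fin nV))) : Finset (Finset (Fin nE)) :=
  Finset.univ.filter (fun F => G.IsForest p F)

/-- The dual spanning forest polynomial `Ψ̃_G^p`, evaluated at `α`. -/
def dualForestPoly (p : Finset (Finset (Fin nV))) (α : Fin nE → ℝ) : ℝ :=
  ∑ F ∈ G.forests p, ∏ e ∈ F, α e

/-- The spanning forest polynomial `Ψ_G^p`, evaluated at `α`. -/
def forestPoly (p : Finset (Finset (Fin nV))) (α : Fin nE → ℝ) : ℝ :=
  ∑ F ∈ G.forests p, ∏ e ∈ Finset.univ \ F, α e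

/-- The partition of the external vertices into singletons. -/
def singlePart : Finset (Finset (Fin nV)) := G.ext.image (fun v => {v})

/-- The collection `p(i,j)` consisting of `{i, j}` together with the singletons of the
remaining external vertices. -/
def pairPart (i j : Fin nV) : Finset (Finset (Fin nV)) :=
  insert ({i, j} : Finset (Fin nV)) (((G.ext.erase i).erase j).image (fun v => {v}))

/-- `Ψ̃_G`, evaluated at `α`. -/
def psiTilde (α : Fin nE → ℝ) : ℝ := G.dualForestPoly G.singlePart α

/-- `Φ̃_G(α, x) = Σ_{i<j external} ‖x_i - x_j‖² Ψ̃_G^{p(i,j)}(α)`. -/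
def phiTilde {d : ℕ} (x : Fin nV → EuclideanSpace ℝ (Fin d)) (α : Fin nE → ℝ) : ℝ :=
  ∑ i ∈ G.ext, ∑ j ∈ G.ext.filter (fun j => i < j),
    ‖x i - x j‖ ^ 2 * G.dualForestPoly (G.pairPart i j) α

/-- Positions of all vertices: external vertices are placed according to `x`,
internal vertices according to `y`. -/
def assemble {E : Type*} (x : Fin nV → E) (y : {v : Fin nV // v ∉ G.ext} → E) :
    Fin nV → E :=
  fun v => if h : v ∉ G.ext then y ⟨v, h⟩ else x v

/-- The position space Feynman integral
`f_G(x) = ∫ ∏_{v internal} d^d x_v/π^{d/2} ∏_e ‖x_{u(e)} - x_{w(e)}‖^{-2λν_e}`,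
a Lebesgue integral of a nonnegative function, with values in `[0,∞]`.  Only the
external components of `x` matter. -/
def posIntegral (d : ℕ) (x : Fin nV → EuclideanSpace ℝ (Fin d)) : ℝ≥0∞ :=
  (∫⁻ y : {v : Fin nV // v ∉ G.ext} → EuclideanSpace ℝ (Fin d),
      ENNReal.ofReal (∏ e,
        ‖G.assemble x y (G.ends e).1 - G.assemble x y (G.ends e).2‖ ^ (-(2 * lam d * G.ν e)))) /
    ENNReal.ofReal (Real.pi ^ ((d : ℝ) / 2 * (G.intVerts.card : ℝ)))

/-- The standard positions of the three external vertices `0`, `1`, `z`. -/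
def extPos (d : ℕ) (v0 v1 vz : Fin nV) (z : ℂ) : Fin nV → EuclideanSpace ℝ (Fin d) :=
  fun v =>
    if v = v0 then 0
    else if v = v1 then WithLp.toLp 2 (fun i => if (i : ℕ) = 0 then 1 else 0)
    else if v = vz then
      WithLp.toLp 2 (fun i => if (i : ℕ) = 0 then z.re else if (i : ℕ) = 1 then z.im else 0)
    else 0

/-- The graphical function `f_G(z)` of a graph with the three external vertices
`v0`, `v1`, `vz`. -/
def graphicalFn (d : ℕ) (v0 v1 vz : Fin nV) (z : ℂ) : ℝ≥0∞ :=
  G.posIntegral d (extPos d v0 v1 vz z)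

/-- The edges of `G` having both endpoints in `Vg`. -/
def edgesWithin (Vg : Finset (Fin nV)) : Finset (Fin nE) :=
  Finset.univ.filter (fun e => (G.ends e).1 ∈ Vg ∧ (G.ends e).2 ∈ Vg)

/-- Ultraviolet convergence. -/
def UVConvergent (d : ℕ) : Prop :=
  ∀ Vg : Finset (Fin nV), 2 ≤ Vg.card → (Vg ∩ G.ext).card ≤ 1 →
    lam d * ∑ e ∈ G.edgesWithin Vg, G.ν e < (d : ℝ) / 2 * ((Vg.card : ℝ) - 1)

/-- `(Vg, Eg)` is a subgraph of `G`. -/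
def IsSubgraph (Vg : Finset (Fin nV)) (Eg : Finset (Fin nE)) : Prop :=
  ∀ e ∈ Eg, (G.ends e).1 ∈ Vg ∧ (G.ends e).2 ∈ Vg

/-- `v` is a `g`-internal vertex of the subgraph `g = (Vg, Eg)`. -/
def GInternal (Vg : Finset (Fin nV)) (Eg : Finset (Fin nE)) (v : Fin nV) : Prop :=
  v ∉ G.ext ∧ v ∈ Vg ∧ ∀ e, G.Incident e v → e ∈ Eg

/-- The set of `g`-internal vertices of the subgraph `g = (Vg, Eg)`. -/
def gInternalSet (Vg : Finset (Fin nV)) (Eg : Finset (Fin nE)) : Finset (Fin nV) :=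
  Finset.univ.filter (fun v => G.GInternal Vg Eg v)

/-- Infrared convergence. -/
def IRConvergent (d : ℕ) : Prop :=
  ∀ Vg : Finset (Fin nV), ∀ Eg : Finset (Fin nE), G.IsSubgraph Vg Eg →
    0 < (G.gInternalSet Vg Eg).card →
    (∀ e ∈ Eg, G.GInternal Vg Eg (G.ends e).1 ∨ G.GInternal Vg Eg (G.ends e).2) →
    (d : ℝ) / 2 * ((G.gInternalSet Vg Eg).card : ℝ) < lam d * ∑ e ∈ Eg, G.ν e

/-- The superficial degree of divergence `M_G = λ ν_G - (d/2)·V_int`. -/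
def Mdeg (d : ℕ) : ℝ := lam d * ∑ e, G.ν e - (d : ℝ) / 2 * (G.intVerts.card : ℝ)

end FeynmanGraph

namespace FeynmanGraph

variable {nV nE : ℕ} (G : FeynmanGraph nV nE)

theorem edgeGraph_adj {F : Finset (Fin nE)} {u v : Fin nV} :
    (G.edgeGraph F).Adj u v ↔ ∃ e ∈ F, G.Joins e u v := by
  simp only [edgeGraph, SimpleGraph.fromRel_adj]
  constructor
  · rintro ⟨-, h | ⟨e, he, h⟩⟩
    · exact h
    · exact ⟨e, he, h.symm⟩
  · rintro ⟨e, he, h⟩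
    refine ⟨?_, Or.inl ⟨e, he, h⟩⟩
    have hne := G.ends_ne e
    rcases h with h | h <;> rw [h] at hne
    · exact hne
    · exact hne.symm

theorem edgeGraph_mono {F F' : Finset (Fin nE)} (h : F ⊆ F') :
    G.edgeGraph F ≤ G.edgeGraph F' := by
  intro u v huv
  rw [edgeGraph_adj] at huv ⊢
  obtain ⟨e, he, hj⟩ := huv
  exact ⟨e, h he, hj⟩

/-- A vertex not incident to any edge of `F` is only reachable from itself. -/
theorem eq_of_reachable_of_not_incident {F : Finset (Fin nE)} {u v : Fin nV}
    (hu : ∀ e ∈ F, ¬ G.Incident e u) (h : (G.edgeGraph F).Reachable u v) : u = v := by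
  obtain ⟨w⟩ := h
  cases w with
  | nil => rfl
  | cons hadj _ =>
    obtain ⟨e, he, hj⟩ := G.edgeGraph_adj.1 hadj
    refine absurd ?_ (hu e he)
    rcases hj with hj | hj <;> simp [Incident, hj]

theorem card_le_card_connectedComponent {F : Finset (Fin nE)} (S : Finset (Fin nV))
    (hS : ∀ u ∈ S, ∀ v ∈ S, (G.edgeGraph F).Reachable u v → u = v) :
    S.card ≤ Nat.card (G.edgeGraph F).ConnectedComponent := by
  rw [← Nat.card_eq_finsetCard S]
  refine Nat.card_le_card_of_injective
    (fun v : S => (G.edgeGraph F).connectedComponentMk v) ?_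
  rintro ⟨u, hu⟩ ⟨v, hv⟩ h
  exact Subtype.ext (hS u hu v hv (SimpleGraph.ConnectedComponent.exact h))

theorem reachable_insert {F : Finset (Fin nE)} {e : Fin nE} {a b : Fin nV}
    (h : (G.edgeGraph (insert e F)).Reachable a b) :
    (G.edgeGraph F).Reachable a b ∨
      (((G.edgeGraph F).Reachable a (G.ends e).1 ∨ (G.edgeGraph F).Reachable a (G.ends e).2) ∧
        ((G.edgeGraph F).Reachable b (G.ends e).1 ∨
          (G.edgeGraph F).Reachable b (G.ends e).2)) := by
  obtain ⟨w⟩ := h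
  induction w with
  | nil => exact Or.inl (SimpleGraph.Reachable.refl _)
  | @cons x y z hadj _ ih =>
    obtain ⟨f, hf, hj⟩ := G.edgeGraph_adj.1 hadj
    rcases Finset.mem_insert.1 hf with rfl | hf
    · have hx : x = (G.ends f).1 ∨ x = (G.ends f).2 := by
        rcases hj with hj | hj <;> simp [hj]
      have hy : y = (G.ends f).1 ∨ y = (G.ends f).2 := by
        rcases hj with hj | hj <;> simp [hj]
      refine Or.inr ⟨?_, ?_⟩
      · rcases hx with hx | hx
        · exact Or.inl (hx ▸ SimpleGraph.Reachable.refl _)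
        · exact Or.inr (hx ▸ SimpleGraph.Reachable.refl _)
      rcases ih with ih | ih
      · rcases hy with hy | hy
        · exact Or.inl (hy ▸ ih.symm)
        · exact Or.inr (hy ▸ ih.symm)
      · exact ih.2
    · have hxy : (G.edgeGraph F).Reachable x y :=
        (G.edgeGraph_adj.2 ⟨f, hf, hj⟩).reachable
      exact ih.imp hxy.trans (And.imp_left (Or.imp hxy.trans hxy.trans))

theorem card_connectedComponent_le_insert (F : Finset (Fin nE)) (e : Fin nE) :
    Nat.card (G.edgeGraph F).ConnectedComponent ≤
      Nat.card (G.edgeGraph (insert e F)).ConnectedComponent + 1 := by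
  rw [← Finite.card_option]
  refine Nat.card_le_card_of_injective
    (fun c : (G.edgeGraph F).ConnectedComponent =>
      if c = (G.edgeGraph F).connectedComponentMk (G.ends e).1 then none
      else some (c.map (SimpleGraph.Hom.ofLE
        (G.edgeGraph_mono (Finset.subset_insert e F))))) ?_
  intro c d h
  induction c using SimpleGraph.ConnectedComponent.ind with | _ a => ?_
  induction d using SimpleGraph.ConnectedComponent.ind with | _ b => ?_
  simp only [SimpleGraph.ConnectedComponent.eq] at h ⊢
  split_ifs at h with ha hb hb
  · exact ha.trans hb.symm
  · have hab := SimpleGraph.ConnectedComponent.exact (Option.some.inj h)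
    rcases G.reachable_insert hab with h | ⟨h1, h2⟩
    · exact h
    · exact (h1.resolve_left ha).trans (h2.resolve_left hb).symm

theorem card_connectedComponent_add_card_le {F F' : Finset (Fin nE)} (h : F' ⊆ F) :
    Nat.card (G.edgeGraph F').ConnectedComponent + F'.card ≤
      Nat.card (G.edgeGraph F).ConnectedComponent + F.card := by
  obtain ⟨D, hD, rfl⟩ : ∃ D, Disjoint F' D ∧ F' ∪ D = F :=
    ⟨F \ F', Finset.disjoint_sdiff, Finset.union_sdiff_of_subset h⟩
  rw [Finset.card_union_of_disjoint hD]
  clear h hD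
  induction D using Finset.induction_on with
  | empty => simp
  | insert e D he ih =>
    have := G.card_connectedComponent_le_insert (F' ∪ D) e
    rw [Finset.union_insert, Finset.card_insert_of_notMem he]
    omega

end FeynmanGraph

/-- Degree bounds for dual spanning forest polynomials: if `F` is a
spanning forest compatible with a collection `p` of pairwise disjoint nonempty subsets
of the external vertex set, then for every subgraph `g = (Vg, Eg)` of `G` with
`Vg ≠ ∅`, the number of `g`-internal vertices is at most `|F ∩ Eg|`, which is at most
`|Vg| - 1`.  (Hence every monomial of `Ψ̃_G^p` contains at least that many and at most
`|Vg| - 1` factors `α_e` with `e ∈ Eg`.) -/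
theorem forest_degree_bounds {nV nE : ℕ} (G : FeynmanGraph nV nE)
    (p : Finset (Finset (Fin nV)))
    (hp_nonempty : ∀ P ∈ p, P.Nonempty)
    (hp_ext : ∀ P ∈ p, P ⊆ G.ext)
    (hp_disj : ∀ P ∈ p, ∀ Q ∈ p, P ≠ Q → Disjoint P Q)
    (F : Finset (Fin nE)) (hF : G.IsForest p F)
    (Vg : Finset (Fin nV)) (Eg : Finset (Fin nE)) (hsub : G.IsSubgraph Vg Eg)
    (hVg : Vg.Nonempty) :
    (G.gInternalSet Vg Eg).card ≤ (F ∩ Eg).card ∧ (F ∩ Eg).card ≤ Vg.card - 1 := by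
  obtain ⟨hcard, hcomp, -, hsep⟩ := hF
  have hbound : ∀ F' ⊆ F,
      Nat.card (G.edgeGraph F').ConnectedComponent + F'.card ≤ nV := fun F' hF' => by
    have := G.card_connectedComponent_add_card_le hF'
    omega
  constructor
  · have : Nonempty (Fin nV) := ⟨hVg.choose⟩
    choose! r hr using hp_nonempty
    have hr_inj : Set.InjOn r p := by
      intro P hP Q hQ h
      by_contra hne
      exact Finset.disjoint_left.1 (hp_disj P hP Q hQ hne) (hr P hP) (h ▸ hr Q hQ)
    have hdisj : Disjoint (G.gInternalSet Vg Eg) (p.image r) := by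
      rw [Finset.disjoint_left]
      intro v hv hv'
      obtain ⟨P, hP, rfl⟩ := Finset.mem_image.1 hv'
      exact (Finset.mem_filter.1 hv).2.1 (hp_ext P hP (hr P hP))
    have hiso : ∀ v ∈ G.gInternalSet Vg Eg, ∀ e ∈ F \ Eg, ¬ G.Incident e v :=
      fun v hv e he hinc =>
        (Finset.mem_sdiff.1 he).2 ((Finset.mem_filter.1 hv).2.2.2 e hinc)
    have hle := G.card_le_card_connectedComponent (F := F \ Eg)
      (G.gInternalSet Vg Eg ∪ p.image r) (by
        intro u hu v hv h
        rcases Finset.mem_union.1 hu with hu | hu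
        · exact G.eq_of_reachable_of_not_incident (hiso u hu) h
        rcases Finset.mem_union.1 hv with hv | hv
        · exact (G.eq_of_reachable_of_not_incident (hiso v hv) h.symm).symm
        obtain ⟨P, hP, rfl⟩ := Finset.mem_image.1 hu
        obtain ⟨Q, hQ, rfl⟩ := Finset.mem_image.1 hv
        by_contra hne
        exact hsep P hP Q hQ (fun h => hne (congrArg r h)) _ (hr P hP) _ (hr Q hQ)
          (h.mono (G.edgeGraph_mono Finset.sdiff_subset)))
    rw [Finset.card_union_of_disjoint hdisj, Finset.card_image_of_injOn hr_inj] at hle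
    have := hbound (F \ Eg) Finset.sdiff_subset
    have := Finset.card_sdiff_add_card_inter F Eg
    omega
  · obtain ⟨v₀, hv₀⟩ := hVg
    have hiso : ∀ v ∈ Vgᶜ, ∀ e ∈ F ∩ Eg, ¬ G.Incident e v := by
      intro v hv e he hinc
      have hends := hsub e (Finset.mem_inter.1 he).2
      rcases hinc with rfl | rfl
      · exact Finset.mem_compl.1 hv hends.1
      · exact Finset.mem_compl.1 hv hends.2
    have hle := G.card_le_card_connectedComponent (F := F ∩ Eg) (insert v₀ Vgᶜ) (by
      intro u hu v hv h
      rcases Finset.mem_insert.1 hu with rfl | hu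
      · rcases Finset.mem_insert.1 hv with rfl | hv
        · rfl
        · exact (G.eq_of_reachable_of_not_incident (hiso v hv) h.symm).symm
      · exact G.eq_of_reachable_of_not_incident (hiso u hu) h)
    rw [Finset.card_insert_of_notMem (by simpa using hv₀), Finset.card_compl,
      Fintype.card_fin] at hle
    have := hbound (F ∩ Eg) Finset.inter_subset_left
    have := Finset.card_le_univ Vg
    rw [Fintype.card_fin] at this
    omega
end
end

section
/- (Bounds on the superficial degree of divergence.) Let G be a Feynman graph with V_int ≠ ∅ such that every edge of G has at least one internal endpoint (no edge joins two external vertices). If G is infrared convergent then M_G > 0. If moreover G is ultraviolet convergent, then for every external vertex v one has M_G < λ · Σ_{w ∈ V_ext, w ≠ v} ν_w, where ν_w denotes the sum of the weights ν_e of all edges e incident to the external vertex w. -/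
open scoped Classical ENNReal
open MeasureTheory

noncomputable section

namespace FeynmanGraph

variable {nV nE : ℕ} (G : FeynmanGraph nV nE)

/-- If no edge joins two external vertices, every edge either avoids the external vertices
other than `v` or is incident to exactly one of them. -/
theorem sum_edgesWithin_add_sum_incident
    (hedge : ∀ e, (G.ends e).1 ∉ G.ext ∨ (G.ends e).2 ∉ G.ext) (v : Fin nV) :
    ∑ e ∈ G.edgesWithin (insert v G.intVerts), G.ν e +
      ∑ w ∈ G.ext.erase v, ∑ e ∈ Finset.univ.filter (fun e => G.Incident e w), G.ν e =
    ∑ e, G.ν e := by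
  have hdisj : (G.ext.erase v : Set (Fin nV)).PairwiseDisjoint
      (fun w => Finset.univ.filter (fun e => G.Incident e w)) := by
    intro a ha b hb hab
    refine Finset.disjoint_left.2 fun e hea heb => ?_
    have := hedge e
    simp only [Finset.coe_erase, Incident] at *
    grind
  have hcompl : (G.ext.erase v).biUnion
      (fun w => Finset.univ.filter (fun e => G.Incident e w)) =
      (G.edgesWithin (insert v G.intVerts))ᶜ := by
    ext e
    simp only [Finset.mem_biUnion, Finset.mem_erase, Finset.mem_filter, Finset.mem_univ,
      true_and, Incident, Finset.mem_compl, edgesWithin, Finset.mem_insert, intVerts]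
    grind
  rw [← Finset.sum_biUnion hdisj, hcompl, Finset.sum_add_sum_compl]

theorem gInternalSet_univ : G.gInternalSet Finset.univ Finset.univ = G.intVerts := by
  simp [gInternalSet, intVerts, GInternal]

theorem Mdeg_pos {d : ℕ} (hint : G.intVerts.Nonempty)
    (hedge : ∀ e, (G.ends e).1 ∉ G.ext ∨ (G.ends e).2 ∉ G.ext)
    (hIR : G.IRConvergent d) : 0 < G.Mdeg d := by
  have h := hIR Finset.univ Finset.univ (by simp [IsSubgraph])
    (by rw [gInternalSet_univ]; exact hint.card_pos) (by simpa [GInternal] using hedge)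
  rw [gInternalSet_univ] at h
  exact sub_pos.2 h

theorem Mdeg_lt_of_UVConvergent {d : ℕ} (hint : G.intVerts.Nonempty)
    (hedge : ∀ e, (G.ends e).1 ∉ G.ext ∨ (G.ends e).2 ∉ G.ext)
    (hUV : G.UVConvergent d) {v : Fin nV} (hv : v ∈ G.ext) :
    G.Mdeg d < lam d * ∑ w ∈ G.ext.erase v,
      ∑ e ∈ Finset.univ.filter (fun e => G.Incident e w), G.ν e := by
  have hcard : (insert v G.intVerts).card = G.intVerts.card + 1 :=
    Finset.card_insert_of_notMem (by simp [intVerts, hv])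
  have hext : insert v G.intVerts ∩ G.ext ⊆ {v} := by
    intro w hw
    simp only [intVerts, Finset.mem_inter, Finset.mem_insert, Finset.mem_filter] at hw
    grind
  have h := hUV (insert v G.intVerts) (by have := hint.card_pos; lia)
    ((Finset.card_le_card hext).trans (by simp))
  rw [hcard, Nat.cast_add, Nat.cast_one, add_sub_cancel_right] at h
  rw [Mdeg, ← G.sum_edgesWithin_add_sum_incident hedge v, mul_add]
  linarith

end FeynmanGraph

/-- Bounds on the superficial degree of divergence.  Suppose `G` has
at least one internal vertex and no edge joins two external vertices.  If `G` is
infrared convergent then `M_G > 0`; if moreover `G` is ultraviolet convergent then for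
every external vertex `v`, `M_G < λ · Σ_{w external, w ≠ v} ν_w`, where `ν_w` is the
sum of the weights of the edges incident to `w`. -/
theorem Mdeg_bounds {d nV nE : ℕ} (hd : 2 < d) (G : FeynmanGraph nV nE)
    (hint : G.intVerts.Nonempty)
    (hedge : ∀ e, (G.ends e).1 ∉ G.ext ∨ (G.ends e).2 ∉ G.ext)
    (hIR : G.IRConvergent d) :
    0 < G.Mdeg d ∧
    (G.UVConvergent d → ∀ v ∈ G.ext,
      G.Mdeg d < lam d * ∑ w ∈ G.ext.erase v,
        ∑ e ∈ Finset.univ.filter (fun e => G.Incident e w), G.ν e) := by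
  exact ⟨G.Mdeg_pos hint hedge hIR,
    fun hUV _ hv => G.Mdeg_lt_of_UVConvergent hint hedge hUV hv⟩
end
end
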